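/- arXiv:math/0603134 — 5 statements merged into one kernel-verified Lean document; each statement's English description precedes it below -/
import Mathlib

section
/- Let n ≥ 1 be an integer, let a = (a_i)_{i≥1} be an absolutely summable real sequence and b ∈ ℝ, and let Q̂ be the diagonal quadratic estimator Q̂(y) = Σ_{i≥1} a_i y_i² + b. Let Θ be an orthosymmetric set of square-summable real sequences and let Q.Hull(Θ) = {θ square-summable : (θ_i²)_{i≥1} ∈ convexHull{(η_i²)_{i≥1} : η ∈ Θ}} be its quadratic convex hull. Then sup_{θ∈Θ} E_θ(Q̂ − Q(θ))² = sup_{θ∈Q.Hull(Θ)} E_θ(Q̂ − Q(θ))², as elements of [0,∞]. -/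
open MeasureTheory ProbabilityTheory Real Filter
open scoped NNReal ENNReal Topology

/-- `P` is the infinite product measure `⊗_{i≥0} N(θ_i, 1/n)` on the sequence space `ℕ → ℝ`:
a probability measure whose value on every measurable cylinder set is the corresponding
finite product of Gaussian probabilities. -/
def IsGaussianSeqMeasure (n : ℕ) (θ : ℕ → ℝ) (P : Measure (ℕ → ℝ)) : Prop :=
  IsProbabilityMeasure P ∧
    ∀ s : Finset ℕ, ∀ A : ℕ → Set ℝ, (∀ i, MeasurableSet (A i)) →
      P {y | ∀ i ∈ s, y i ∈ A i} = ∏ i ∈ s, gaussianReal (θ i) ((n : ℝ≥0))⁻¹ (A i)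

/-- The quadratic functional `Q(θ) = ∑ θ_i²`. -/
noncomputable def Qfun (θ : ℕ → ℝ) : ℝ := ∑' i, (θ i) ^ 2

/-- The risk `E_θ (δ - Q(θ))²`, valued in `[0,∞]`. -/
noncomputable def risk (P : Measure (ℕ → ℝ)) (δ : (ℕ → ℝ) → ℝ) (θ : ℕ → ℝ) : ℝ≥0∞ :=
  ∫⁻ y, ENNReal.ofReal ((δ y - Qfun θ) ^ 2) ∂P

/-- Θ is orthosymmetric: sign flips of coordinates stay in Θ. -/
def Orthosymmetric (Θ : Set (ℕ → ℝ)) : Prop :=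
  ∀ θ ∈ Θ, ∀ ε : ℕ → ℝ, (∀ i, ε i = 1 ∨ ε i = -1) → (fun i => ε i * θ i) ∈ Θ

/-- The set of coordinatewise squares of elements of Θ. -/
def SquaresOf (Θ : Set (ℕ → ℝ)) : Set (ℕ → ℝ) :=
  (fun θ => fun i => (θ i) ^ 2) '' Θ

/-- The quadratic convex hull of Θ: square-summable sequences whose squares lie in the
convex hull of the squares of elements of Θ. -/
def QHull (Θ : Set (ℕ → ℝ)) : Set (ℕ → ℝ) :=
  {θ | Summable (fun i => (θ i) ^ 2) ∧ (fun i => (θ i) ^ 2) ∈ convexHull ℝ (SquaresOf Θ)}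

section GaussianMoments

variable {v : ℝ≥0}

lemma integrable_pow_gaussianReal (θ : ℝ) (k : ℕ) :
    Integrable (fun x => x ^ k) (gaussianReal θ v) := by
  rcases Nat.eq_zero_or_pos k with rfl | hk
  · simp
  · have h := (memLp_id_gaussianReal (μ := θ) (v := v) k).integrable_norm_pow hk.ne'
    refine h.mono (by fun_prop) (ae_of_all _ fun x => ?_)
    simp

lemma integral_gaussianReal_eq_integral_add (θ : ℝ) (f : ℝ → ℝ) (hf : Continuous f) :
    ∫ x, f x ∂gaussianReal θ v = ∫ z, f (z + θ) ∂gaussianReal 0 v := by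
  rw [← integral_map (φ := fun z => z + θ) (by fun_prop) (by fun_prop),
    gaussianReal_map_add_const, zero_add]

lemma integral_sq_gaussianReal_zero : ∫ z, z ^ 2 ∂gaussianReal 0 v = v := by
  have h := variance_fun_id_gaussianReal (μ := 0) (v := v)
  rw [variance_eq_sub (X := fun x => x) (memLp_id_gaussianReal 2)] at h
  simpa [integral_id_gaussianReal] using h

lemma integral_cube_gaussianReal_zero : ∫ z, z ^ 3 ∂gaussianReal 0 v = 0 := by
  have h : ∫ z, z ^ 3 ∂gaussianReal 0 v = ∫ z, (-z) ^ 3 ∂gaussianReal 0 v := by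
    rw [← integral_map (φ := fun z : ℝ => -z) (f := fun z => z ^ 3) (by fun_prop) (by fun_prop),
      gaussianReal_map_neg, neg_zero]
  have h' : ∫ z, (-z) ^ 3 ∂gaussianReal 0 v = -∫ z, z ^ 3 ∂gaussianReal 0 v := by
    rw [← integral_neg]
    exact integral_congr_ae (ae_of_all _ fun z => by ring)
  linarith

lemma integral_sq_gaussianReal (θ : ℝ) : ∫ x, x ^ 2 ∂gaussianReal θ v = θ ^ 2 + v := by
  have h := variance_fun_id_gaussianReal (μ := θ) (v := v)
  rw [variance_eq_sub (X := fun x => x) (memLp_id_gaussianReal 2)] at h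
  simp only [integral_id_gaussianReal, Pi.pow_apply] at h
  linarith

lemma memLp_sq_gaussianReal (θ : ℝ) : MemLp (fun x => x ^ 2) 2 (gaussianReal θ v) := by
  rw [memLp_two_iff_integrable_sq (by fun_prop)]
  simpa [← pow_mul] using integrable_pow_gaussianReal θ 4

lemma integral_pow_four_gaussianReal (θ : ℝ) :
    ∫ x, x ^ 4 ∂gaussianReal θ v =
      ∫ z, z ^ 4 ∂gaussianReal 0 v + 6 * θ ^ 2 * v + θ ^ 4 := by
  rw [integral_gaussianReal_eq_integral_add θ _ (by fun_prop)]
  have h1 := integrable_pow_gaussianReal (v := v) 0 1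
  have h2 := integrable_pow_gaussianReal (v := v) 0 2
  have h3 := integrable_pow_gaussianReal (v := v) 0 3
  have h4 := integrable_pow_gaussianReal (v := v) 0 4
  have e : (fun z : ℝ => (z + θ) ^ 4) = fun z =>
      z ^ 4 + (4 * θ) * z ^ 3 + (6 * θ ^ 2) * z ^ 2 + (4 * θ ^ 3) * z ^ 1 + θ ^ 4 := by
    ext z; ring
  rw [e, integral_add (by fun_prop) (by fun_prop), integral_add (by fun_prop) (by fun_prop),
    integral_add (by fun_prop) (by fun_prop), integral_add (by fun_prop) (by fun_prop)]
  simp only [integral_const_mul, integral_cube_gaussianReal_zero, integral_sq_gaussianReal_zero]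
  simp [integral_id_gaussianReal]

lemma variance_sq_gaussianReal (θ : ℝ) :
    Var[fun x => x ^ 2; gaussianReal θ v] =
      4 * v * θ ^ 2 + (∫ z, z ^ 4 ∂gaussianReal 0 v - v ^ 2) := by
  rw [variance_eq_sub (memLp_sq_gaussianReal θ), integral_sq_gaussianReal]
  simp only [Pi.pow_apply, ← pow_mul]
  norm_num [integral_pow_four_gaussianReal θ]
  ring

end GaussianMoments

section WeightedSum

variable {Ω : Type*} [MeasurableSpace Ω] {μ : Measure Ω} {X : ℕ → Ω → ℝ} {a : ℕ → ℝ}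

lemma lintegral_sq_tsum_enorm_lt_top (hX : ∀ i, AEMeasurable (X i) μ) {C : ℝ≥0∞} (hC : C ≠ ∞)
    (hXC : ∀ i, ∫⁻ ω, ‖X i ω‖ₑ ^ 2 ∂μ ≤ C) (ha : Summable fun i => |a i|) :
    ∫⁻ ω, (∑' i, ‖a i * X i ω‖ₑ) ^ 2 ∂μ < ∞ := by
  have hA : ∑' i, ‖a i‖ₑ ≠ ∞ := by
    have := ha.tsum_ofReal_ne_top
    simpa [← ofReal_norm] using this
  have hpair (x y : ℝ≥0∞) : x * y ≤ x ^ 2 + y ^ 2 := by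
    rcases le_total x y with h | h
    · exact (mul_le_mul_left h y).trans (by rw [← sq]; exact le_add_self)
    · exact (mul_le_mul_right h x).trans (by rw [← sq]; exact le_self_add)
  have hmeas (i : ℕ) : AEMeasurable (fun ω => ‖a i * X i ω‖ₑ) μ := ((hX i).const_mul _).enorm
  calc ∫⁻ ω, (∑' i, ‖a i * X i ω‖ₑ) ^ 2 ∂μ
      = ∫⁻ ω, ∑' i, ∑' j, ‖a i * X i ω‖ₑ * ‖a j * X j ω‖ₑ ∂μ := by
        simp only [sq, ENNReal.tsum_mul_left, ENNReal.tsum_mul_right]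
    _ = ∑' i, ∑' j, ∫⁻ ω, ‖a i * X i ω‖ₑ * ‖a j * X j ω‖ₑ ∂μ := by
        have hm (i j : ℕ) : AEMeasurable (fun ω => ‖a i * X i ω‖ₑ * ‖a j * X j ω‖ₑ) μ :=
          (hmeas i).mul (hmeas j)
        rw [lintegral_tsum fun i => AEMeasurable.tsum (hm i)]
        exact tsum_congr fun i => lintegral_tsum (hm i)
    _ ≤ ∑' i, ∑' j, ‖a i‖ₑ * (‖a j‖ₑ * (C + C)) := by
        refine ENNReal.tsum_le_tsum fun i => ENNReal.tsum_le_tsum fun j => ?_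
        calc ∫⁻ ω, ‖a i * X i ω‖ₑ * ‖a j * X j ω‖ₑ ∂μ
            ≤ ∫⁻ ω, (‖a i‖ₑ * ‖a j‖ₑ) * (‖X i ω‖ₑ ^ 2 + ‖X j ω‖ₑ ^ 2) ∂μ := by
              refine lintegral_mono fun ω => ?_
              rw [enorm_mul, enorm_mul, mul_mul_mul_comm]
              gcongr
              exact hpair _ _
          _ = (‖a i‖ₑ * ‖a j‖ₑ) * (∫⁻ ω, ‖X i ω‖ₑ ^ 2 ∂μ + ∫⁻ ω, ‖X j ω‖ₑ ^ 2 ∂μ) := by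
              rw [lintegral_const_mul' _ _ (by finiteness),
                lintegral_add_left' ((hX i).enorm.pow_const 2)]
          _ ≤ ‖a i‖ₑ * (‖a j‖ₑ * (C + C)) := by
              rw [mul_assoc]
              gcongr <;> exact hXC _
    _ = (∑' i, ‖a i‖ₑ) * ((∑' i, ‖a i‖ₑ) * (C + C)) := by
        simp only [ENNReal.tsum_mul_left, ENNReal.tsum_mul_right]
    _ < ∞ := by finiteness

/-- Second moment of an absolutely convergent weighted series of pairwise independent variables
which is shifted by a constant. -/
lemma lintegral_sq_tsum_add [IsProbabilityMeasure μ] (hX : ∀ i, MemLp (X i) 2 μ)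
    (hind : Pairwise fun i j => IndepFun (X i) (X j) μ)
    {C : ℝ} (hXC : ∀ i, ∫ ω, X i ω ^ 2 ∂μ ≤ C) (ha : Summable fun i => |a i|) (c : ℝ)
    (hm : Summable fun i => a i * ∫ ω, X i ω ∂μ)
    (hw : Summable fun i => a i ^ 2 * Var[X i; μ]) :
    ∫⁻ ω, ENNReal.ofReal ((∑' i, a i * X i ω + c) ^ 2) ∂μ =
      ENNReal.ofReal (∑' i, a i ^ 2 * Var[X i; μ] + (∑' i, a i * ∫ ω, X i ω ∂μ + c) ^ 2) := by
  have hXm (i : ℕ) : AEMeasurable (X i) μ := (hX i).aemeasurable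
  have hXC' (i : ℕ) : ∫⁻ ω, ‖X i ω‖ₑ ^ 2 ∂μ ≤ ENNReal.ofReal C := by
    refine le_trans (le_of_eq ?_) (ENNReal.ofReal_le_ofReal (hXC i))
    rw [ofReal_integral_eq_lintegral_ofReal (hX i).integrable_sq (ae_of_all _ fun _ => sq_nonneg _)]
    refine lintegral_congr fun ω => ?_
    rw [← ofReal_norm, ← ENNReal.ofReal_pow (norm_nonneg _), Real.norm_eq_abs, sq_abs]
  set T : Ω → ℝ≥0∞ := fun ω => ∑' i, ‖a i * X i ω‖ₑ with hT
  have hTm : AEMeasurable T μ :=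
    AEMeasurable.tsum fun i => ((hXm i).const_mul _).enorm
  have hT2 : ∫⁻ ω, T ω ^ 2 ∂μ < ∞ :=
    lintegral_sq_tsum_enorm_lt_top hXm ENNReal.ofReal_ne_top hXC' ha
  have hTfin : ∀ᵐ ω ∂μ, T ω ≠ ∞ := by
    filter_upwards [ae_lt_top' (hTm.pow_const 2) hT2.ne] with ω hω h
    simp [h] at hω
  have hTL : MemLp (fun ω => (T ω).toReal) 2 μ := by
    rw [memLp_two_iff_integrable_sq hTm.ennreal_toReal.aestronglyMeasurable]
    simpa using integrable_toReal_of_lintegral_ne_top (hTm.pow_const 2) hT2.ne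
  have hbound : Integrable (fun ω => ((T ω).toReal + |c|) ^ 2) μ :=
    (hTL.add (memLp_const |c|)).integrable_sq
  have hsum : ∀ᵐ ω ∂μ, Summable fun i => |a i * X i ω| := by
    filter_upwards [hTfin] with ω hω
    have := ENNReal.summable_toReal hω
    simpa using this
  have hTr : ∀ᵐ ω ∂μ, (T ω).toReal = ∑' i, |a i * X i ω| := by
    refine ae_of_all _ fun ω => ?_
    rw [hT, ENNReal.tsum_toReal_eq fun _ => enorm_ne_top]
    simp
  set U : ℕ → Ω → ℝ := fun N ω => ∑ i ∈ Finset.range N, a i * X i ω + c with hU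
  have hUL (N : ℕ) : MemLp (U N) 2 μ :=
    (memLp_finsetSum _ fun i _ => (hX i).const_mul (a i)).add (memLp_const c)
  have hUlim : ∀ᵐ ω ∂μ, Tendsto (fun N => U N ω ^ 2) atTop (𝓝 ((∑' i, a i * X i ω + c) ^ 2)) := by
    filter_upwards [hsum] with ω hω
    exact ((hω.of_abs.hasSum.tendsto_sum_nat).add_const c).pow 2
  have hUb (N : ℕ) : ∀ᵐ ω ∂μ, ‖U N ω ^ 2‖ ≤ ((T ω).toReal + |c|) ^ 2 := by
    filter_upwards [hsum, hTr] with ω hω hωT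
    rw [norm_pow, Real.norm_eq_abs, hωT]
    gcongr
    refine (abs_add_le _ _).trans ?_
    gcongr
    exact (Finset.abs_sum_le_sum_abs _ _).trans (hω.sum_le_tsum _ fun _ _ => abs_nonneg _)
  have hconv := tendsto_integral_of_dominated_convergence _
    (fun N => (hUL N).integrable_sq.aestronglyMeasurable) hbound hUb hUlim
  have hUint (N : ℕ) : ∫ ω, U N ω ^ 2 ∂μ = ∑ i ∈ Finset.range N, a i ^ 2 * Var[X i; μ]
      + (∑ i ∈ Finset.range N, a i * ∫ ω, X i ω ∂μ + c) ^ 2 := by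
    have hmean : ∫ ω, U N ω ∂μ = ∑ i ∈ Finset.range N, a i * ∫ ω, X i ω ∂μ + c := by
      have hi (i : ℕ) : Integrable (fun ω => a i * X i ω) μ :=
        ((hX i).integrable one_le_two).const_mul _
      rw [hU, integral_add (integrable_finsetSum _ fun i _ => hi i) (integrable_const c),
        integral_finsetSum _ fun i _ => hi i]
      simp [integral_const_mul]
    have hvar : Var[U N; μ] = ∑ i ∈ Finset.range N, a i ^ 2 * Var[X i; μ] := by
      have hL (i : ℕ) : MemLp (fun ω => a i * X i ω) 2 μ := (hX i).const_mul (a i)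
      rw [hU, variance_add_const (memLp_finsetSum _ fun i _ => hL i).aestronglyMeasurable]
      have h := IndepFun.variance_sum (X := fun i ω => a i * X i ω) (s := Finset.range N)
        (μ := μ) (fun i _ => hL i) (fun i _ j _ hij =>
          (hind hij).comp (measurable_const_mul (a i)) (measurable_const_mul (a j)))
      rw [Finset.sum_fn] at h
      rw [h]
      exact Finset.sum_congr rfl fun i _ => variance_const_mul _ _ _
    have h := variance_eq_sub (hUL N)
    rw [hvar, hmean] at h
    simp only [Pi.pow_apply] at h
    linarith
  have hlim2 := (hw.hasSum.tendsto_sum_nat).add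
    (((hm.hasSum.tendsto_sum_nat).add_const c).pow 2)
  have hval := tendsto_nhds_unique hconv (by simpa only [hUint] using hlim2)
  have hint : Integrable (fun ω => (∑' i, a i * X i ω + c) ^ 2) μ := by
    refine hbound.mono' (aestronglyMeasurable_of_tendsto_ae atTop
      (fun N => (hUL N).integrable_sq.aestronglyMeasurable) hUlim) ?_
    filter_upwards [ae_all_iff.2 hUb, hUlim] with ω hb hl
    exact le_of_tendsto hl.norm (Eventually.of_forall hb)
  rw [← ofReal_integral_eq_lintegral_ofReal hint (ae_of_all _ fun _ => sq_nonneg _), hval]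

end WeightedSum

lemma IsGaussianSeqMeasure.eq_infinitePi {n : ℕ} {θ : ℕ → ℝ} {P : Measure (ℕ → ℝ)}
    (h : IsGaussianSeqMeasure n θ P) :
    P = Measure.infinitePi fun i => gaussianReal (θ i) ((n : ℝ≥0))⁻¹ :=
  Measure.eq_infinitePi _ fun s t ht => h.2 s t ht

lemma Summable.le_tsum_abs {s : ℕ → ℝ} (hs : Summable s) (i : ℕ) : |s i| ≤ ∑' j, |s j| :=
  hs.abs.le_tsum i fun _ _ => abs_nonneg _

lemma Summable.mul_of_abs {a s : ℕ → ℝ} (ha : Summable fun i => |a i|) (hs : Summable s) :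
    Summable fun i => a i * s i := by
  refine Summable.of_norm_bounded (ha.mul_right (∑' j, |s j|)) fun i => ?_
  rw [norm_mul, Real.norm_eq_abs, Real.norm_eq_abs]
  gcongr
  exact hs.le_tsum_abs i

lemma Summable.abs_sq {a : ℕ → ℝ} (ha : Summable fun i => |a i|) :
    Summable fun i => |a i ^ 2| := by
  simpa only [sq, abs_mul] using Summable.mul_of_abs (a := fun i => |a i|)
    (by simpa only [abs_abs] using ha) (s := fun i => |a i|) ha

/-- The risk of the diagonal estimator with weights `a` and offset `b`, as a function of the
squares `s` of the parameter: `v` is the noise variance and `κ` the variance of the squared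
noise. -/
noncomputable def diagonalRisk (a : ℕ → ℝ) (b v κ : ℝ) (s : ℕ → ℝ) : ℝ :=
  ∑' i, a i ^ 2 * (4 * v * s i + κ) + (∑' i, a i * (s i + v) + (b - ∑' i, s i)) ^ 2

lemma risk_eq_diagonalRisk {n : ℕ} {a : ℕ → ℝ} (ha : Summable fun i => |a i|) (b : ℝ)
    {θ : ℕ → ℝ} (hθ : Summable fun i => θ i ^ 2) {P : Measure (ℕ → ℝ)}
    (hP : IsGaussianSeqMeasure n θ P) :
    risk P (fun y => (∑' i, a i * y i ^ 2) + b) θ =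
      ENNReal.ofReal (diagonalRisk a b ((n : ℝ≥0)⁻¹ : ℝ≥0)
        (∫ z, z ^ 4 ∂gaussianReal 0 (n : ℝ≥0)⁻¹ - (((n : ℝ≥0)⁻¹ : ℝ≥0) : ℝ) ^ 2)
        fun i => θ i ^ 2) := by
  obtain rfl := hP.eq_infinitePi
  set v : ℝ≥0 := (n : ℝ≥0)⁻¹
  set κ : ℝ := ∫ z, z ^ 4 ∂gaussianReal 0 v - (v : ℝ) ^ 2 with hκ
  set μ := Measure.infinitePi fun i => gaussianReal (θ i) v
  have hmp (i : ℕ) : MeasurePreserving (Function.eval i) μ (gaussianReal (θ i) v) :=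
    measurePreserving_eval_infinitePi _ i
  have hL (i : ℕ) : MemLp (fun y : ℕ → ℝ => y i ^ 2) 2 μ :=
    (memLp_sq_gaussianReal (θ i)).comp_measurePreserving (hmp i)
  have hmean (i : ℕ) : ∫ y, y i ^ 2 ∂μ = θ i ^ 2 + v := by
    rw [← integral_sq_gaussianReal (θ i), ← (hmp i).map_eq,
      integral_map (hmp i).aemeasurable (by fun_prop)]
  have hvar (i : ℕ) : Var[fun y : ℕ → ℝ => y i ^ 2; μ] = 4 * v * θ i ^ 2 + κ := by
    rw [hκ, ← variance_sq_gaussianReal (θ i), ← (hmp i).map_eq,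
      variance_map (by fun_prop) (hmp i).aemeasurable]
    rfl
  have hfour (i : ℕ) : ∫ y, (y i ^ 2) ^ 2 ∂μ = 4 * v * θ i ^ 2 + κ + (θ i ^ 2 + v) ^ 2 := by
    have h := variance_eq_sub (hL i)
    rw [hvar, hmean] at h
    simp only [Pi.pow_apply] at h
    linarith
  have hind : Pairwise fun i j =>
      IndepFun (fun y : ℕ → ℝ => y i ^ 2) (fun y : ℕ → ℝ => y j ^ 2) μ := fun i j hij =>
    (iIndepFun_infinitePi (P := fun i => gaussianReal (θ i) v) (X := fun _ (x : ℝ) => x ^ 2)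
      fun _ => by fun_prop).indepFun hij
  have hle (i : ℕ) : θ i ^ 2 ≤ ∑' j, θ j ^ 2 := hθ.le_tsum i fun _ _ => sq_nonneg _
  have hmain := lintegral_sq_tsum_add hL hind
    (C := 4 * v * (∑' j, θ j ^ 2) + κ + ((∑' j, θ j ^ 2) + v) ^ 2)
    (fun i => by rw [hfour]; gcongr <;> exact hle i) ha (b - ∑' i, θ i ^ 2)
    (by
      simp only [hmean, mul_add]
      exact (ha.mul_of_abs hθ).add (ha.of_abs.mul_right _))
    (by
      simp only [hvar, mul_add]
      exact (ha.abs_sq.mul_of_abs (hθ.mul_left _)).add (ha.abs_sq.of_abs.mul_right _))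
  simp only [hmean, hvar] at hmain
  rw [diagonalRisk, ← hmain, risk]
  simp only [Qfun, add_sub_assoc]

lemma diagonalRisk_convexOn {a : ℕ → ℝ} (ha : Summable fun i => |a i|) (b v κ : ℝ) :
    ConvexOn ℝ {s | Summable s} (diagonalRisk a b v κ) := by
  refine ⟨fun x hx y hy p q _ _ _ => (hx.mul_left p).add (hy.mul_left q),
    fun x hx y hy p q hp hq hpq => ?_⟩
  have hx : Summable x := hx
  have hy : Summable y := hy
  have hV {s : ℕ → ℝ} (hs : Summable s) : Summable fun i => a i ^ 2 * (4 * v * s i + κ) := by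
    simp only [mul_add]
    exact (ha.abs_sq.mul_of_abs (hs.mul_left _)).add (ha.abs_sq.of_abs.mul_right _)
  have hM {s : ℕ → ℝ} (hs : Summable s) : Summable fun i => a i * (s i + v) := by
    simp only [mul_add]
    exact (ha.mul_of_abs hs).add (ha.of_abs.mul_right _)
  obtain rfl : q = 1 - p := by linarith
  have eV : ∑' i, a i ^ 2 * (4 * v * (p * x i + (1 - p) * y i) + κ) =
      p * ∑' i, a i ^ 2 * (4 * v * x i + κ) + (1 - p) * ∑' i, a i ^ 2 * (4 * v * y i + κ) := by
    rw [← tsum_mul_left, ← tsum_mul_left,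
      ← ((hV hx).mul_left p).tsum_add ((hV hy).mul_left (1 - p))]
    exact tsum_congr fun i => by ring
  have eM : ∑' i, a i * (p * x i + (1 - p) * y i + v) =
      p * ∑' i, a i * (x i + v) + (1 - p) * ∑' i, a i * (y i + v) := by
    rw [← tsum_mul_left, ← tsum_mul_left,
      ← ((hM hx).mul_left p).tsum_add ((hM hy).mul_left (1 - p))]
    exact tsum_congr fun i => by ring
  have eQ : ∑' i, (p * x i + (1 - p) * y i) = p * ∑' i, x i + (1 - p) * ∑' i, y i := by
    rw [← tsum_mul_left, ← tsum_mul_left, ← (hx.mul_left p).tsum_add (hy.mul_left (1 - p))]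
  simp only [diagonalRisk, Pi.add_apply, Pi.smul_apply, smul_eq_mul, eV, eM, eQ]
  nlinarith [mul_nonneg (mul_nonneg hp hq) (sq_nonneg
    ((∑' i, a i * (x i + v) - ∑' i, x i) - (∑' i, a i * (y i + v) - ∑' i, y i)))]

/-- for a diagonal quadratic estimator and an orthosymmetric set Θ of
square-summable sequences, the maximum risk over Θ equals the maximum risk over the
quadratic convex hull of Θ. -/
theorem sup_risk_eq_sup_risk_QHull (n : ℕ) (hn : 1 ≤ n)
    (a : ℕ → ℝ) (ha : Summable fun i => |a i|) (b : ℝ)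
    (Θ : Set (ℕ → ℝ)) (hΘsq : ∀ θ ∈ Θ, Summable fun i => (θ i) ^ 2)
    (hΘ : Orthosymmetric Θ)
    (P : (ℕ → ℝ) → Measure (ℕ → ℝ)) (hP : ∀ θ, IsGaussianSeqMeasure n θ (P θ)) :
    (⨆ θ ∈ Θ, risk (P θ) (fun y => (∑' i, a i * (y i) ^ 2) + b) θ) =
      ⨆ θ ∈ QHull Θ, risk (P θ) (fun y => (∑' i, a i * (y i) ^ 2) + b) θ := by
  refine le_antisymm (biSup_mono fun θ hθ =>
    ⟨hΘsq θ hθ, subset_convexHull ℝ _ ⟨θ, hθ, rfl⟩⟩) (iSup₂_le fun θ hθ => ?_)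
  rw [risk_eq_diagonalRisk ha b hθ.1 (hP θ)]
  set F := diagonalRisk a b ((n : ℝ≥0)⁻¹ : ℝ≥0)
    (∫ z, z ^ 4 ∂gaussianReal 0 (n : ℝ≥0)⁻¹ - (((n : ℝ≥0)⁻¹ : ℝ≥0) : ℝ) ^ 2)
  set B := ⨆ θ ∈ Θ, risk (P θ) (fun y => (∑' i, a i * (y i) ^ 2) + b) θ with hB
  have hF : ConvexOn ℝ {s | Summable s} F := diagonalRisk_convexOn ha _ _ _
  have hconv : Convex ℝ {s | Summable s ∧ ENNReal.ofReal (F s) ≤ B} := by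
    rintro x ⟨hx, hxB⟩ y ⟨hy, hyB⟩ p q hp hq hpq
    refine ⟨hF.1 hx hy hp hq hpq, ?_⟩
    refine (ENNReal.ofReal_le_ofReal (hF.le_max_of_mem_segment hx hy
      ⟨p, q, hp, hq, hpq, rfl⟩)).trans ?_
    rw [ENNReal.ofReal_max]
    exact max_le hxB hyB
  refine (convexHull_min ?_ hconv hθ.2).2
  rintro _ ⟨η, hη, rfl⟩
  refine ⟨hΘsq η hη, ?_⟩
  rw [← risk_eq_diagonalRisk ha b (hΘsq η hη) (hP η)]
  exact le_iSup₂_of_le η hη le_rfl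
end

section
/- Let n > 0 be real and τ ≥ 1, and set μ₀ = ∫ (x² − τ/n)_+ dN(0, 1/n)(x). Then |μ₀| ≤ 4 / (√(2π) · n · τ^{1/2} · e^{τ/2}). -/
open MeasureTheory ProbabilityTheory Real
open scoped NNReal ENNReal

open Set Filter Topology in
/-- The Gaussian integral of `z² - a²` over `(a, ∞)`, without normalization, is at most
`2 a⁻¹ exp (-a² / 2)` for `a ≥ 1`. -/
theorem integral_Ioi_sq_sub_sq_mul_exp_le {a : ℝ} (ha : 1 ≤ a) :
    ∫ z in Ioi a, (z ^ 2 - a ^ 2) * exp (-z ^ 2 / 2) ≤ 2 / a * exp (-a ^ 2 / 2) := by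
  set h : ℝ → ℝ := fun z ↦ z - (a ^ 2 - 1) * (z / (1 + z ^ 2)) with hh
  set D : ℝ → ℝ := fun z ↦
    (z ^ 2 - a ^ 2 + (a ^ 2 - 1) * (2 / (1 + z ^ 2) ^ 2)) * exp (-z ^ 2 / 2) with hD
  have hderiv : ∀ z ∈ Ici a, HasDerivAt (fun z ↦ -(h z * exp (-z ^ 2 / 2))) (D z) z := by
    intro z _
    have hz : 1 + z ^ 2 ≠ 0 := by positivity
    have e : HasDerivAt (fun z : ℝ ↦ exp (-z ^ 2 / 2)) (exp (-z ^ 2 / 2) * (-z)) z := by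
      have := (((hasDerivAt_id z).pow 2).neg.div_const 2).exp
      convert this using 1
      · simp
      · simp
        ring
    have q : HasDerivAt (fun z : ℝ ↦ 1 + z ^ 2) (2 * z) z := by
      simpa using ((hasDerivAt_id z).pow 2).const_add 1
    have hderiv_h : HasDerivAt h (1 - (a ^ 2 - 1) *
        ((1 * (1 + z ^ 2) - z * (2 * z)) / (1 + z ^ 2) ^ 2)) z :=
      (hasDerivAt_id z).sub (((hasDerivAt_id z).div q hz).const_mul (a ^ 2 - 1))
    refine (hderiv_h.mul e).neg.congr_deriv ?_
    simp only [hD, hh]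
    field_simp
    ring
  have hpos : ∀ z ∈ Ioi a, 0 ≤ z ^ 2 - a ^ 2 := fun z hz ↦ by
    have : a < z := hz
    nlinarith
  have ha2 : 0 ≤ a ^ 2 - 1 := by nlinarith
  have hDnonneg : ∀ z ∈ Ioi a, 0 ≤ D z := fun z hz ↦ by
    have := hpos z hz
    positivity
  have hlim : Tendsto (fun z ↦ -(h z * exp (-z ^ 2 / 2))) atTop (𝓝 0) := by
    have hexp : Tendsto (fun z : ℝ ↦ a ^ 2 * (z ^ 1 * exp (-z))) atTop (𝓝 0) := by
      simpa using (tendsto_pow_mul_exp_neg_atTop_nhds_zero 1).const_mul (a ^ 2)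
    refine squeeze_zero_norm' ?_ hexp
    filter_upwards [eventually_ge_atTop 2] with z hz
    have hz1 : 0 ≤ z / (1 + z ^ 2) := by positivity
    have hz2 : z / (1 + z ^ 2) ≤ z := div_le_self (by linarith) (by nlinarith)
    have hb : |h z| ≤ a ^ 2 * z := by
      rw [abs_le]
      constructor <;> simp only [hh] <;> nlinarith [mul_nonneg ha2 hz1,
        mul_le_mul_of_nonneg_left hz2 ha2]
    rw [norm_neg, norm_mul, norm_eq_abs, norm_of_nonneg (exp_pos _).le, pow_one, ← mul_assoc]
    gcongr
    nlinarith
  have hint := integrableOn_Ioi_deriv_of_nonneg' hderiv hDnonneg hlim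
  have hval := integral_Ioi_of_hasDerivAt_of_nonneg' hderiv hDnonneg hlim
  calc ∫ z in Ioi a, (z ^ 2 - a ^ 2) * exp (-z ^ 2 / 2)
      ≤ ∫ z in Ioi a, D z := by
        refine integral_mono_of_nonneg ?_ hint ?_ <;>
          filter_upwards [ae_restrict_mem measurableSet_Ioi] with z hz
        · exact mul_nonneg (hpos z hz) (exp_pos _).le
        · simp only [hD]
          gcongr
          exact le_add_of_nonneg_right (by positivity)
    _ = h a * exp (-a ^ 2 / 2) := by rw [hval]; ring
    _ ≤ 2 / a * exp (-a ^ 2 / 2) := by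
        gcongr
        have : h a = 2 * a / (1 + a ^ 2) := by
          simp only [hh]
          field_simp
          ring
        rw [this, div_le_div_iff₀ (by positivity) (by positivity)]
        nlinarith

open Set in
/-- The standard Gaussian mean of `(z² - τ)₊` as an integral over `(√τ, ∞)`. -/
theorem integral_max_sq_sub_gaussianReal {τ : ℝ} (hτ : 0 ≤ τ) :
    ∫ z, max (z ^ 2 - τ) 0 ∂(gaussianReal 0 1) =
      2 * ((√(2 * π))⁻¹ * ∫ z in Ioi √τ, (z ^ 2 - √τ ^ 2) * exp (-z ^ 2 / 2)) := by
  rw [integral_gaussianReal_eq_integral_smul one_ne_zero]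
  have habs := integral_comp_abs
    (f := fun z : ℝ ↦ (√(2 * π))⁻¹ * (max (z ^ 2 - τ) 0 * exp (-z ^ 2 / 2)))
  have hsub : ∫ z in Ioi √τ, max (z ^ 2 - τ) 0 * exp (-z ^ 2 / 2) =
      ∫ z in Ioi 0, max (z ^ 2 - τ) 0 * exp (-z ^ 2 / 2) := by
    refine (setIntegral_eq_of_subset_of_forall_sdiff_eq_zero measurableSet_Ioi
      (Ioi_subset_Ioi (sqrt_nonneg τ)) fun z hz ↦ ?_).symm
    have hz0 : 0 < z := hz.1
    have hz1 : z ≤ √τ := not_lt.1 hz.2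
    have : z ^ 2 ≤ τ := (le_sqrt hz0.le hτ).1 hz1
    rw [max_eq_right (by linarith), zero_mul]
  have hpos : ∫ z in Ioi √τ, (z ^ 2 - √τ ^ 2) * exp (-z ^ 2 / 2) =
      ∫ z in Ioi √τ, max (z ^ 2 - τ) 0 * exp (-z ^ 2 / 2) := by
    refine setIntegral_congr_fun measurableSet_Ioi fun z hz ↦ ?_
    have : τ < z ^ 2 := (sqrt_lt' ((sqrt_nonneg τ).trans_lt hz)).1 hz
    simp only [sq_sqrt hτ, max_eq_left (sub_nonneg.2 this.le)]
  rw [hpos, hsub, ← integral_const_mul, ← habs]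
  refine integral_congr_ae (.of_forall fun z ↦ ?_)
  simp [gaussianPDFReal]
  ring

/-- Scaling the variance of the Gaussian in the mean of `(x² - τ / n)₊`. -/
theorem integral_max_sq_sub_gaussianReal_scale {n : ℝ} (τ : ℝ) (hn : 0 < n) :
    ∫ x, max (x ^ 2 - τ / n) 0 ∂(gaussianReal 0 (Real.toNNReal (1 / n))) =
      1 / n * ∫ z, max (z ^ 2 - τ) 0 ∂(gaussianReal 0 1) := by
  have hmap : gaussianReal 0 (Real.toNNReal (1 / n)) =
      (gaussianReal 0 1).map (fun x ↦ √(1 / n) * x) := by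
    rw [gaussianReal_map_const_mul]
    congr 1
    · simp
    · ext
      simp [hn.le]
  rw [hmap, integral_map (by fun_prop) (by fun_prop), ← integral_const_mul]
  congr 1 with z
  rw [mul_pow, sq_sqrt (by positivity), mul_max_of_nonneg _ _ (by positivity)]
  ring_nf

/-- with `μ₀ = E_0 (X² - τ/n)₊` for `X ~ N(0, 1/n)` and `τ ≥ 1`,
`|μ₀| ≤ 4 / (√(2π) n √τ e^{τ/2})`. -/
theorem abs_mu0_le (n τ : ℝ) (hn : 0 < n) (hτ : 1 ≤ τ) :
    |∫ x, max (x ^ 2 - τ / n) 0 ∂(gaussianReal 0 (Real.toNNReal (1 / n)))| ≤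
      4 / (Real.sqrt (2 * π) * n * Real.sqrt τ * Real.exp (τ / 2)) := by
  have hτ0 : 0 < τ := by linarith
  have hsτ : 0 < √τ := sqrt_pos.2 hτ0
  rw [abs_of_nonneg (integral_nonneg fun x ↦ le_max_right _ _),
    integral_max_sq_sub_gaussianReal_scale τ hn, integral_max_sq_sub_gaussianReal hτ0.le]
  calc _ ≤ 1 / n * (2 * ((√(2 * π))⁻¹ * (2 / √τ * exp (-√τ ^ 2 / 2)))) := by
        gcongr
        exact integral_Ioi_sq_sub_sq_mul_exp_le (one_le_sqrt.2 hτ)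
    _ = _ := by
        rw [sq_sqrt hτ0.le, neg_div, exp_neg]
        field_simp
        norm_num
end

section
/- Let n > 0 and τ > 0 be real. Then ∫ (x² − τ/n)_+ dN(0, 1/n)(x) = (2τ^{1/2})/(√(2π) · n) · e^{−τ/2} − (2(τ − 1)/n) · (1 − Φ(τ^{1/2})). -/
open MeasureTheory ProbabilityTheory Real
open scoped NNReal ENNReal

/-- The standard normal cumulative distribution function Φ. -/
noncomputable def stdNormalCDF (x : ℝ) : ℝ := (gaussianReal 0 1 (Set.Iic x)).toReal

lemma gaussianPDFReal_zero_one (x : ℝ) :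
    gaussianPDFReal 0 1 x = (√(2 * π))⁻¹ * rexp (-(1 / 2) * x ^ 2) := by
  simp only [gaussianPDFReal, NNReal.coe_one, mul_one, sub_zero]
  congr 2
  ring

lemma hasDerivAt_gaussianPDFReal_zero_one (x : ℝ) :
    HasDerivAt (gaussianPDFReal 0 1) (-x * gaussianPDFReal 0 1 x) x := by
  rw [funext gaussianPDFReal_zero_one]
  convert! ((((hasDerivAt_id x).pow 2).const_mul (-(1 / 2) : ℝ)).exp).const_mul
    (√(2 * π))⁻¹ using 1
  simp
  ring

lemma hasDerivAt_neg_mul_gaussianPDFReal_zero_one (x : ℝ) :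
    HasDerivAt (fun y ↦ -y * gaussianPDFReal 0 1 y) ((x ^ 2 - 1) * gaussianPDFReal 0 1 x) x := by
  convert! (hasDerivAt_neg x).mul (hasDerivAt_gaussianPDFReal_zero_one x) using 1
  ring

lemma tendsto_neg_mul_gaussianPDFReal_zero_one :
    Filter.Tendsto (fun y ↦ -y * gaussianPDFReal 0 1 y) Filter.atTop (nhds 0) := by
  have h := ((tendsto_rpow_abs_mul_exp_neg_mul_sq_cocompact (a := 1 / 2) (by norm_num) 1).mono_left
    atTop_le_cocompact).const_mul (-(√(2 * π))⁻¹)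
  rw [mul_zero] at h
  refine h.congr' ?_
  filter_upwards [Filter.eventually_ge_atTop 0] with x hx
  rw [gaussianPDFReal_zero_one, abs_of_nonneg hx, rpow_one]
  ring

lemma integrable_sq_mul_gaussianPDFReal_zero_one :
    Integrable (fun x ↦ x ^ 2 * gaussianPDFReal 0 1 x) := by
  have h := (integrable_rpow_mul_exp_neg_mul_sq (b := 1 / 2) (by norm_num)
    (s := 2) (by norm_num)).const_mul (√(2 * π))⁻¹
  refine h.congr (.of_forall fun x ↦ ?_)
  simp only [gaussianPDFReal_zero_one, rpow_two]
  ring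

lemma setIntegral_Ioi_gaussianPDFReal_zero_one (a : ℝ) :
    ∫ x in Set.Ioi a, gaussianPDFReal 0 1 x = 1 - stdNormalCDF a := by
  have h := probReal_compl_eq_one_sub (μ := gaussianReal 0 1) (measurableSet_Iic (a := a))
  rw [Set.compl_Iic, measureReal_def, gaussianReal_apply_eq_integral 0 one_ne_zero,
    ENNReal.toReal_ofReal (integral_nonneg fun x ↦ gaussianPDFReal_nonneg 0 1 x)] at h
  exact h

lemma setIntegral_Ioi_sq_sub_one_mul_gaussianPDFReal_zero_one (a : ℝ) :
    ∫ x in Set.Ioi a, (x ^ 2 - 1) * gaussianPDFReal 0 1 x = a * gaussianPDFReal 0 1 a := by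
  rw [integral_Ioi_of_hasDerivAt_of_tendsto'
    (fun x _ ↦ hasDerivAt_neg_mul_gaussianPDFReal_zero_one x) ?_
    tendsto_neg_mul_gaussianPDFReal_zero_one]
  · ring
  · simp only [sub_mul, one_mul]
    exact (integrable_sq_mul_gaussianPDFReal_zero_one.sub
      (integrable_gaussianPDFReal 0 1)).integrableOn

lemma setIntegral_Ioi_sq_sub_mul_gaussianPDFReal_zero_one (a t : ℝ) :
    ∫ x in Set.Ioi a, (x ^ 2 - t) * gaussianPDFReal 0 1 x =
      a * gaussianPDFReal 0 1 a - (t - 1) * (1 - stdNormalCDF a) := by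
  rw [← setIntegral_Ioi_sq_sub_one_mul_gaussianPDFReal_zero_one,
    ← setIntegral_Ioi_gaussianPDFReal_zero_one, ← integral_const_mul, ← integral_sub]
  · congr 1 with x
    ring
  · simp only [sub_mul, one_mul]
    exact (integrable_sq_mul_gaussianPDFReal_zero_one.sub
      (integrable_gaussianPDFReal 0 1)).integrableOn
  · exact ((integrable_gaussianPDFReal 0 1).const_mul _).integrableOn

lemma integral_pos_part_sq_sub_gaussianReal_zero_one {t : ℝ} (ht : 0 ≤ t) :
    ∫ x, max (x ^ 2 - t) 0 ∂(gaussianReal 0 1) =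
      2 * (√t * gaussianPDFReal 0 1 √t - (t - 1) * (1 - stdNormalCDF √t)) := by
  rw [integral_gaussianReal_eq_integral_smul one_ne_zero,
    ← setIntegral_Ioi_sq_sub_mul_gaussianPDFReal_zero_one]
  have habs (x : ℝ) : gaussianPDFReal 0 1 x • max (x ^ 2 - t) 0 =
      (fun y ↦ max (y ^ 2 - t) 0 * gaussianPDFReal 0 1 y) |x| := by
    simp only [gaussianPDFReal_zero_one, sq_abs, smul_eq_mul, mul_comm]
  rw [integral_congr_ae (.of_forall habs),
    integral_comp_abs (f := fun y ↦ max (y ^ 2 - t) 0 * gaussianPDFReal 0 1 y)]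
  congr 1
  rw [setIntegral_eq_of_subset_of_forall_sdiff_eq_zero measurableSet_Ioi
    (Set.Ioi_subset_Ioi (sqrt_nonneg t))]
  · refine setIntegral_congr_fun measurableSet_Ioi fun x hx ↦ ?_
    have := (sqrt_lt' ((sqrt_nonneg t).trans_lt hx)).1 hx
    simp only [max_eq_left (sub_nonneg.2 this.le)]
  · intro x hx
    have := (le_sqrt (le_of_lt hx.1) ht).1 (not_lt.1 hx.2)
    simp only [max_eq_right (sub_nonpos.2 this), zero_mul]

/-- exact formula for `E_0 (X² - τ/n)₊` when `X ~ N(0, 1/n)`: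
`μ₀ = 2√τ/(√(2π) n) e^{-τ/2} - (2(τ-1)/n)(1 - Φ(√τ))`. -/
theorem integral_pos_part_sq_sub_eq (n τ : ℝ) (hn : 0 < n) (hτ : 0 < τ) :
    ∫ x, max (x ^ 2 - τ / n) 0 ∂(gaussianReal 0 (Real.toNNReal (1 / n))) =
      2 * Real.sqrt τ / (Real.sqrt (2 * π) * n) * Real.exp (-τ / 2)
        - (2 * (τ - 1) / n) * (1 - stdNormalCDF (Real.sqrt τ)) := by
  have hmap : gaussianReal 0 (Real.toNNReal (1 / n)) =
      (gaussianReal 0 1).map (fun x ↦ (√n)⁻¹ * x) := by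
    rw [gaussianReal_map_const_mul]
    congr 1
    · simp
    · ext
      simp [hn.le]
  have hscale (x : ℝ) : max (((√n)⁻¹ * x) ^ 2 - τ / n) 0 = n⁻¹ * max (x ^ 2 - τ) 0 := by
    rw [mul_max_of_nonneg _ _ (inv_nonneg.2 hn.le), mul_zero, mul_pow, inv_pow, sq_sqrt hn.le]
    congr 1
    ring
  rw [hmap, integral_map (by fun_prop) (by fun_prop)]
  simp only [hscale]
  rw [integral_const_mul, integral_pos_part_sq_sub_gaussianReal_zero_one hτ.le,
    gaussianPDFReal_zero_one, sq_sqrt hτ.le, show -(1 / 2) * τ = -τ / 2 by ring]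
  field_simp
end

section
/- Let n > 0 be real, let m ≥ 4 be an integer and k = ⌈m^{1/2}⌉. Let Θ_m ⊆ ℝ^m consist of the zero vector together with all vectors having exactly k coordinates equal to n^{-1/2} and the remaining coordinates equal to 0, and for θ ∈ ℝ^m let P_θ = ⊗_{j=1}^m N(θ_j, 1/n). Let Q̂ : ℝ^m → ℝ be any measurable estimator satisfying ∫ Q̂(y)² dP_0(y) ≤ c·m/n² for some constant c with 0 < c < (1/64)e^{1−e}. Then sup_{θ ∈ Θ_m} ∫ (Q̂(y) − Σ_{j=1}^m θ_j²)² dP_θ(y) ≥ (1/4 − 2e^{(e−1)/2} c^{1/2}) · m/n². -/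
open MeasureTheory ProbabilityTheory Real
open scoped NNReal ENNReal

/-- `Θ_m`: the zero vector together with all vectors in `ℝ^m` having exactly
`k = ⌈√m⌉` coordinates equal to `n^{-1/2}` and the rest equal to `0`. -/
noncomputable def ThetaM (n : ℝ) (m : ℕ) : Set (Fin m → ℝ) :=
  {0} ∪ {θ | ∃ S : Finset (Fin m), S.card = ⌈Real.sqrt m⌉₊ ∧
    θ = fun j => if j ∈ S then 1 / Real.sqrt n else 0}

/-- The product Gaussian measure `⊗_{j=1}^m N(θ_j, 1/n)` on `ℝ^m`. -/
noncomputable def prodGaussian (n : ℝ) {m : ℕ} (θ : Fin m → ℝ) : Measure (Fin m → ℝ) :=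
  Measure.pi fun j => gaussianReal (θ j) (Real.toNNReal (1 / n))

theorem MeasureTheory.Measure.pi_withDensity {ι : Type*} [Fintype ι] {X : ι → Type*}
    [∀ i, MeasurableSpace (X i)] (μ : ∀ i, Measure (X i)) [∀ i, IsProbabilityMeasure (μ i)]
    (f : ∀ i, X i → ℝ≥0∞) (hf : ∀ i, Measurable (f i))
    [∀ i, SigmaFinite ((μ i).withDensity (f i))] :
    Measure.pi (fun i => (μ i).withDensity (f i)) =
      (Measure.pi μ).withDensity (fun x => ∏ i, f i (x i)) := by
  classical
  refine Measure.pi_eq fun s hs => ?_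
  have h_ind : (Set.univ.pi s).indicator (fun x => ∏ i, f i (x i)) =
      fun x => ∏ i, (s i).indicator (f i) (x i) := by
    ext x
    by_cases hx : x ∈ Set.univ.pi s
    · rw [Set.indicator_of_mem hx]
      exact Finset.prod_congr rfl fun i _ =>
        (Set.indicator_of_mem (hx i (Set.mem_univ i)) _).symm
    · rw [Set.indicator_of_notMem hx]
      simp only [Set.mem_univ_pi, not_forall] at hx
      obtain ⟨i, hi⟩ := hx
      exact (Finset.prod_eq_zero (Finset.mem_univ i) (Set.indicator_of_notMem hi _)).symm
  have h_meas : ∀ i, Measurable ((s i).indicator (f i)) := fun i => (hf i).indicator (hs i)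
  rw [withDensity_apply _ (MeasurableSet.univ_pi hs),
    ← lintegral_indicator (MeasurableSet.univ_pi hs), h_ind,
    lintegral_prod_eq_prod_lintegral_of_indepFun Finset.univ
      (fun i (x : ∀ i, X i) => (s i).indicator (f i) (x i))
      (iIndepFun_pi fun i => (h_meas i).aemeasurable)
      (fun i => (h_meas i).comp (measurable_pi_apply i))]
  refine Finset.prod_congr rfl fun i _ => ?_
  rw [withDensity_apply _ (hs i), ← lintegral_indicator (hs i),
    (measurePreserving_eval μ i).lintegral_comp (h_meas i)]

theorem gaussianReal_eq_withDensity_gaussianReal_zero (μ : ℝ) {v : ℝ≥0} (hv : v ≠ 0) :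
    gaussianReal μ v = (gaussianReal 0 v).withDensity
      fun x => ENNReal.ofReal (Real.exp (μ * x / v - μ ^ 2 / (2 * v))) := by
  rw [gaussianReal_of_var_ne_zero μ hv, gaussianReal_of_var_ne_zero 0 hv,
    ← withDensity_mul _ (measurable_gaussianPDF 0 v) (by fun_prop)]
  congr 1
  ext x
  have hv' : (v : ℝ) ≠ 0 := by exact_mod_cast hv
  rw [Pi.mul_apply, gaussianPDF, gaussianPDF, ← ENNReal.ofReal_mul (gaussianPDFReal_nonneg _ _ _),
    gaussianPDFReal, gaussianPDFReal, mul_assoc (√(2 * π * v))⁻¹, ← Real.exp_add]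
  congr 3
  field_simp
  ring

/-- The likelihood ratio of `prodGaussian n θ` with respect to `prodGaussian n 0`. -/
noncomputable def gaussianLikelihood (n : ℝ) {m : ℕ} (θ y : Fin m → ℝ) : ℝ :=
  Real.exp (∑ j, n * (θ j * y j - θ j ^ 2 / 2))

theorem gaussianLikelihood_nonneg (n : ℝ) {m : ℕ} (θ y : Fin m → ℝ) :
    0 ≤ gaussianLikelihood n θ y :=
  (Real.exp_pos _).le

theorem measurable_gaussianLikelihood (n : ℝ) {m : ℕ} (θ : Fin m → ℝ) :
    Measurable (gaussianLikelihood n θ) := by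
  unfold gaussianLikelihood
  fun_prop

theorem gaussianLikelihood_mul (n : ℝ) {m : ℕ} (θ η y : Fin m → ℝ) :
    gaussianLikelihood n θ y * gaussianLikelihood n η y =
      Real.exp (n * ∑ j, θ j * η j) * gaussianLikelihood n (θ + η) y := by
  simp only [gaussianLikelihood, ← Real.exp_add, Finset.mul_sum, ← Finset.sum_add_distrib,
    Pi.add_apply]
  congr 1
  exact Finset.sum_congr rfl fun j _ => by ring

instance (n : ℝ) {m : ℕ} (θ : Fin m → ℝ) : IsProbabilityMeasure (prodGaussian n θ) := by
  unfold prodGaussian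
  infer_instance

theorem prodGaussian_eq_withDensity {n : ℝ} (hn : 0 < n) {m : ℕ} (θ : Fin m → ℝ) :
    prodGaussian n θ = (prodGaussian n (0 : Fin m → ℝ)).withDensity
      fun y => ENNReal.ofReal (gaussianLikelihood n θ y) := by
  have hv : Real.toNNReal (1 / n) ≠ 0 := by simpa using hn
  have hv' : ((Real.toNNReal (1 / n) : ℝ≥0) : ℝ) = 1 / n := Real.coe_toNNReal _ (by positivity)
  unfold prodGaussian
  simp_rw [fun j => gaussianReal_eq_withDensity_gaussianReal_zero (θ j) hv]
  rw [Measure.pi_withDensity _ _ (fun j => by fun_prop)]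
  simp only [Pi.zero_apply]
  congr 1
  ext y
  rw [← ENNReal.ofReal_prod_of_nonneg (fun _ _ => (Real.exp_pos _).le), ← Real.exp_sum,
    gaussianLikelihood]
  congr 2
  refine Finset.sum_congr rfl fun j _ => ?_
  rw [hv']
  field_simp

theorem lintegral_gaussianLikelihood {n : ℝ} (hn : 0 < n) {m : ℕ} (θ : Fin m → ℝ) :
    ∫⁻ y, ENNReal.ofReal (gaussianLikelihood n θ y) ∂(prodGaussian n (0 : Fin m → ℝ)) = 1 := by
  rw [← setLIntegral_univ, ← withDensity_apply _ MeasurableSet.univ,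
    ← prodGaussian_eq_withDensity hn, measure_univ]

theorem lintegral_gaussianLikelihood_mul {n : ℝ} (hn : 0 < n) {m : ℕ} (θ η : Fin m → ℝ) :
    ∫⁻ y, ENNReal.ofReal (gaussianLikelihood n θ y * gaussianLikelihood n η y)
      ∂(prodGaussian n (0 : Fin m → ℝ)) = ENNReal.ofReal (Real.exp (n * ∑ j, θ j * η j)) := by
  simp_rw [gaussianLikelihood_mul, ENNReal.ofReal_mul (Real.exp_pos _).le]
  rw [lintegral_const_mul _ (measurable_gaussianLikelihood n _).ennreal_ofReal,
    lintegral_gaussianLikelihood hn, mul_one]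

theorem choose_sub_mul_pow_le {m k : ℕ} (hkm : k ≤ m) {a : ℕ} (ha : a ≤ k) :
    (m - a).choose (k - a) * m ^ a ≤ m.choose k * k ^ a := by
  induction a with
  | zero => simp
  | succ a ih =>
    obtain ⟨d, rfl⟩ := Nat.exists_eq_add_of_le ha
    obtain ⟨r, rfl⟩ := Nat.exists_eq_add_of_le hkm
    have ih := ih (by omega)
    have e1 : a + 1 + d + r - (a + 1) = d + r := by omega
    have e2 : a + 1 + d - (a + 1) = d := by omega
    have e3 : a + 1 + d + r - a = d + r + 1 := by omega
    have e4 : a + 1 + d - a = d + 1 := by omega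
    rw [e3, e4] at ih
    rw [e1, e2]
    have hc := Nat.add_one_mul_choose_eq (d + r) d
    refine le_of_mul_le_mul_left ?_ (by omega : 0 < d + r + 1)
    calc (d + r + 1) * ((d + r).choose d * (a + 1 + d + r) ^ (a + 1))
        = ((d + r + 1).choose (d + 1) * (a + 1 + d + r) ^ a) *
            ((d + 1) * (a + 1 + d + r)) := by
          rw [pow_succ, ← mul_assoc, hc]; ring
      _ ≤ ((a + 1 + d + r).choose (a + 1 + d) * (a + 1 + d) ^ a) *
            ((d + r + 1) * (a + 1 + d)) := Nat.mul_le_mul ih (by nlinarith)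
      _ = _ := by rw [pow_succ]; ring

/-- The hypergeometric moment generating function is at most the binomial one. -/
theorem sum_powersetCard_pow_card_inter_le {m k : ℕ} (hm : 0 < m) (S : Finset (Fin m))
    (hS : S.card = k) {x : ℝ} (hx : 0 ≤ x) :
    ∑ T ∈ Finset.powersetCard k Finset.univ, (1 + x) ^ (S ∩ T).card ≤
      m.choose k * (1 + x * (k / m)) ^ k := by
  have hm' : (0 : ℝ) < m := by exact_mod_cast hm
  have hkm : k ≤ m := by simpa [hS] using S.card_le_univ
  have h_expand : ∀ T : Finset (Fin m), (1 + x) ^ (S ∩ T).card =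
      ∑ A ∈ S.powerset, if A ⊆ T then x ^ A.card else 0 := by
    intro T
    rw [← Finset.sum_filter, ← Finset.prod_const, Finset.prod_one_add]
    simp only [Finset.prod_const]
    refine Finset.sum_congr ?_ fun _ _ => rfl
    ext A
    simp only [Finset.mem_powerset, Finset.mem_filter, Finset.subset_inter_iff]
  simp_rw [h_expand]
  rw [Finset.sum_comm, ← hS, ← Finset.prod_const, Finset.prod_one_add, Finset.mul_sum]
  refine Finset.sum_le_sum fun A hA => ?_
  have hAk : A.card ≤ k := hS ▸ Finset.card_le_card (Finset.mem_powerset.mp hA)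
  rw [← Finset.sum_filter, Finset.sum_const, Finset.prod_const, hS,
    Finset.card_filter_powersetCard_subset _ _ _ (Finset.subset_univ A) hAk, Finset.card_univ,
    Fintype.card_fin, nsmul_eq_mul, mul_pow, div_pow]
  have h : ((m - A.card).choose (k - A.card) : ℝ) * m ^ A.card ≤ m.choose k * k ^ A.card := by
    exact_mod_cast choose_sub_mul_pow_le hkm hAk
  rw [← le_div_iff₀ (by positivity)] at h
  calc _ ≤ (m.choose k : ℝ) * k ^ A.card / m ^ A.card * x ^ A.card := by gcongr
    _ = _ := by ring

/-- The constrained risk inequality: an estimator with small risk under `μ` has large risk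
under a mixture of alternatives with densities `L i` whose `L²(μ)` norm is controlled. -/
theorem ofReal_sq_le_add_of_mixture {Ω ι : Type*} [MeasurableSpace Ω] {μ : Measure Ω}
    {s : Finset ι} (hs : s.Nonempty) {L : ι → Ω → ℝ} (hL : ∀ i, Measurable (L i))
    (hL0 : ∀ i ω, 0 ≤ L i ω) (hL1 : ∀ i ∈ s, ∫⁻ ω, ENNReal.ofReal (L i ω) ∂μ = 1)
    {g : ι → ι → ℝ} (hg0 : ∀ i j, 0 ≤ g i j)
    (hg : ∀ i ∈ s, ∀ j ∈ s, ∫⁻ ω, ENNReal.ofReal (L i ω * L j ω) ∂μ = ENNReal.ofReal (g i j))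
    {C : ℝ} (hC : ∀ i ∈ s, ∑ j ∈ s, g i j ≤ s.card * C)
    {Q : Ω → ℝ} (hQ : Measurable Q) {q t B : ℝ} (hq : 0 ≤ q) (ht : 0 < t) (hB : 0 ≤ B)
    (hQB : ∫⁻ ω, ENNReal.ofReal (Q ω ^ 2) ∂μ ≤ ENNReal.ofReal B) {R : ℝ≥0∞}
    (hR : ∀ i ∈ s, ∫⁻ ω, ENNReal.ofReal ((Q ω - q) ^ 2) ∂(μ.withDensity
      fun ω => ENNReal.ofReal (L i ω)) ≤ R) :
    ENNReal.ofReal (q ^ 2) ≤ R + ENNReal.ofReal (q * (t * B + C / t)) := by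
  have hN : (0 : ℝ) < s.card := by exact_mod_cast hs.card_pos
  set W : Ω → ℝ := fun ω => (s.card : ℝ)⁻¹ * ∑ i ∈ s, L i ω with hW
  have hW0 : ∀ ω, 0 ≤ W ω := fun ω =>
    mul_nonneg (by positivity) (Finset.sum_nonneg fun i _ => hL0 i ω)
  have hWm : Measurable W := by fun_prop
  have hNinv : ENNReal.ofReal (s.card : ℝ)⁻¹ * s.card = 1 := by
    rw [← ENNReal.ofReal_natCast, ← ENNReal.ofReal_mul (by positivity),
      inv_mul_cancel₀ hN.ne', ENNReal.ofReal_one]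
  have h_weight : ∀ f : Ω → ℝ, Measurable f → (∀ ω, 0 ≤ f ω) →
      ∫⁻ ω, ENNReal.ofReal (f ω * W ω) ∂μ =
        ENNReal.ofReal (s.card : ℝ)⁻¹ * ∑ i ∈ s, ∫⁻ ω, ENNReal.ofReal (f ω * L i ω) ∂μ := by
    intro f hf hf0
    rw [← lintegral_finsetSum _ (fun i _ => by fun_prop), ← lintegral_const_mul _ (by fun_prop)]
    refine lintegral_congr fun ω => ?_
    rw [← ENNReal.ofReal_sum_of_nonneg (fun i _ => mul_nonneg (hf0 ω) (hL0 i ω)),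
      ← ENNReal.ofReal_mul (by positivity), ← Finset.mul_sum, hW]
    congr 1
    ring
  have h_avg : ∀ (F : ι → ℝ≥0∞) (b : ℝ≥0∞), (∀ i ∈ s, F i ≤ b) →
      ENNReal.ofReal (s.card : ℝ)⁻¹ * ∑ i ∈ s, F i ≤ b := by
    intro F b hF
    calc _ ≤ ENNReal.ofReal (s.card : ℝ)⁻¹ * (s.card * b) := by
          gcongr
          simpa using Finset.sum_le_card_nsmul s F b hF
      _ = b := by rw [← mul_assoc, hNinv, one_mul]
  have h_mass : ∫⁻ ω, ENNReal.ofReal (W ω) ∂μ = 1 := by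
    have := h_weight (fun _ => 1) measurable_const (fun _ => zero_le_one)
    simp only [one_mul] at this
    rw [this, Finset.sum_congr rfl hL1]
    simpa using hNinv
  have h_risk : ∫⁻ ω, ENNReal.ofReal ((Q ω - q) ^ 2 * W ω) ∂μ ≤ R := by
    rw [h_weight _ (by fun_prop) (fun ω => sq_nonneg _)]
    refine h_avg _ _ fun i hi => le_trans (le_of_eq ?_) (hR i hi)
    rw [lintegral_withDensity_eq_lintegral_mul _ (hL i).ennreal_ofReal (by fun_prop)]
    refine lintegral_congr fun ω => ?_
    rw [Pi.mul_apply, ENNReal.ofReal_mul (sq_nonneg _), mul_comm]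
  have hC0 : 0 ≤ C := by
    obtain ⟨i, hi⟩ := hs
    exact nonneg_of_mul_nonneg_right ((Finset.sum_nonneg fun j _ => hg0 i j).trans (hC i hi)) hN
  have h_sq : ∫⁻ ω, ENNReal.ofReal (W ω * W ω) ∂μ ≤ ENNReal.ofReal C := by
    rw [h_weight W hWm hW0]
    refine h_avg _ _ fun i hi => ?_
    simp_rw [fun ω => mul_comm (W ω) (L i ω)]
    rw [h_weight (L i) (hL i) (hL0 i), Finset.sum_congr rfl (hg i hi),
      ← ENNReal.ofReal_sum_of_nonneg (fun j _ => hg0 i j), ← ENNReal.ofReal_mul (by positivity)]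
    refine ENNReal.ofReal_le_ofReal ?_
    rw [inv_mul_le_iff₀ hN]
    exact hC i hi
  have h_pt : ∀ ω, ENNReal.ofReal (q ^ 2) * ENNReal.ofReal (W ω) ≤
      ENNReal.ofReal ((Q ω - q) ^ 2 * W ω) +
        (ENNReal.ofReal (q * t) * ENNReal.ofReal (Q ω ^ 2) +
          ENNReal.ofReal (q / t) * ENNReal.ofReal (W ω * W ω)) := by
    intro ω
    have hw := hW0 ω
    rw [← ENNReal.ofReal_mul (by positivity), ← ENNReal.ofReal_mul (by positivity),
      ← ENNReal.ofReal_mul (by positivity), ← ENNReal.ofReal_add (by positivity) (by positivity),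
      ← ENNReal.ofReal_add (by positivity) (by positivity)]
    refine ENNReal.ofReal_le_ofReal ?_
    have h1 : q * t * Q ω ^ 2 + q / t * (W ω * W ω) - 2 * q * Q ω * W ω =
        q / t * (t * Q ω - W ω) ^ 2 := by
      field_simp
      ring
    have h2 : 0 ≤ q / t * (t * Q ω - W ω) ^ 2 := by positivity
    have h3 : 0 ≤ Q ω ^ 2 * W ω := by positivity
    linarith
  calc ENNReal.ofReal (q ^ 2)
      = ∫⁻ ω, ENNReal.ofReal (q ^ 2) * ENNReal.ofReal (W ω) ∂μ := by
        rw [lintegral_const_mul _ hWm.ennreal_ofReal, h_mass, mul_one]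
    _ ≤ _ := lintegral_mono h_pt
    _ = ∫⁻ ω, ENNReal.ofReal ((Q ω - q) ^ 2 * W ω) ∂μ +
          (ENNReal.ofReal (q * t) * ∫⁻ ω, ENNReal.ofReal (Q ω ^ 2) ∂μ +
            ENNReal.ofReal (q / t) * ∫⁻ ω, ENNReal.ofReal (W ω * W ω) ∂μ) := by
        rw [lintegral_add_left (by fun_prop), lintegral_add_left (by fun_prop),
          lintegral_const_mul _ (by fun_prop), lintegral_const_mul _ (by fun_prop)]
    _ ≤ R + (ENNReal.ofReal (q * t) * ENNReal.ofReal B +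
          ENNReal.ofReal (q / t) * ENNReal.ofReal C) := by gcongr
    _ = R + ENNReal.ofReal (q * (t * B + C / t)) := by
        rw [← ENNReal.ofReal_mul (by positivity), ← ENNReal.ofReal_mul (by positivity),
          ← ENNReal.ofReal_add (by positivity) (by positivity)]
        congr 2
        ring

theorem ceil_sqrt_le_mul_sqrt {m : ℕ} (hm : 4 ≤ m) :
    (⌈Real.sqrt m⌉₊ : ℝ) ≤ 3 / 2 * Real.sqrt m := by
  have h2 : 2 ≤ Real.sqrt m := Real.le_sqrt_of_sq_le (by norm_num; exact_mod_cast hm)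
  have := Nat.ceil_lt_add_one (Real.sqrt_nonneg m)
  linarith

theorem one_add_mul_div_pow_le {m k : ℕ} (hm : 0 < m) (hk : (k : ℝ) ≤ 3 / 2 * Real.sqrt m) :
    (1 + (Real.exp 1 - 1) * (k / m)) ^ k ≤ (4 * Real.exp ((Real.exp 1 - 1) / 2)) ^ 2 := by
  have hm' : (0 : ℝ) < m := by exact_mod_cast hm
  have he : 1 ≤ Real.exp 1 := Real.one_le_exp zero_le_one
  have he' := Real.exp_one_lt_d9
  have hlog := Real.log_two_gt_d9
  have hk2 : (k : ℝ) * (k / m) ≤ 9 / 4 := by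
    rw [← mul_div_assoc, div_le_iff₀ hm']
    nlinarith [Real.sq_sqrt hm'.le, Real.sqrt_nonneg (m : ℝ)]
  have h16 : (16 : ℝ) = Real.exp (4 * Real.log 2) := by
    rw [← Real.log_rpow two_pos, Real.exp_log (by positivity)]
    norm_num
  calc (1 + (Real.exp 1 - 1) * (k / m)) ^ k
      ≤ (Real.exp ((Real.exp 1 - 1) * (k / m))) ^ k := by
        have : 0 ≤ (Real.exp 1 - 1) * (k / m : ℝ) := mul_nonneg (by linarith) (by positivity)
        gcongr
        linarith [Real.add_one_le_exp ((Real.exp 1 - 1) * (k / m : ℝ))]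
    _ = Real.exp ((Real.exp 1 - 1) * (k * (k / m))) := by
        rw [← Real.exp_nat_mul]
        congr 1
        ring
    _ ≤ Real.exp (4 * Real.log 2 + (Real.exp 1 - 1)) := by
        refine Real.exp_le_exp.mpr ?_
        nlinarith
    _ = (4 * Real.exp ((Real.exp 1 - 1) / 2)) ^ 2 := by
        rw [Real.exp_add, ← h16, mul_pow, ← Real.exp_nat_mul]
        congr 1
        · norm_num
        · congr 1
          push_cast
          ring

/-- any estimator with small risk at `θ = 0` has maximum risk over `Θ_m`
at least `(1/4 - 2 e^{(e-1)/2} √c) m / n²`. -/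
theorem sup_risk_lower_bound (n : ℝ) (hn : 0 < n) (m : ℕ) (hm : 4 ≤ m)
    (Qhat : (Fin m → ℝ) → ℝ) (hQmeas : Measurable Qhat) (c : ℝ) (hc0 : 0 < c)
    (hc1 : c < (1 / 64) * Real.exp (1 - Real.exp 1))
    (hQ : (∫⁻ y, ENNReal.ofReal ((Qhat y) ^ 2) ∂(prodGaussian n (0 : Fin m → ℝ))) ≤
      ENNReal.ofReal (c * m / n ^ 2)) :
    ENNReal.ofReal ((1 / 4 - 2 * Real.exp ((Real.exp 1 - 1) / 2) * Real.sqrt c) * m / n ^ 2) ≤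
      ⨆ θ ∈ ThetaM n m,
        ∫⁻ y, ENNReal.ofReal ((Qhat y - ∑ j, (θ j) ^ 2) ^ 2) ∂(prodGaussian n θ) := by
  classical
  have hm0 : 0 < m := by omega
  have hm' : (0 : ℝ) < m := by exact_mod_cast hm0
  set k := ⌈Real.sqrt m⌉₊
  have hwk : Real.sqrt m ≤ k := Nat.le_ceil _
  have hk32 : (k : ℝ) ≤ 3 / 2 * Real.sqrt m := ceil_sqrt_le_mul_sqrt hm
  have hw2 : Real.sqrt m ^ 2 = m := Real.sq_sqrt hm'.le
  have hw4 : 2 ≤ Real.sqrt m := Real.le_sqrt_of_sq_le (by norm_num; exact_mod_cast hm)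
  have hkm : k ≤ m := by
    have : (k : ℝ) ≤ m := by nlinarith
    exact_mod_cast this
  set K := Real.exp ((Real.exp 1 - 1) / 2) with hK
  have hK0 : 0 < K := Real.exp_pos _
  have hKc : K * Real.sqrt c ≤ 1 / 8 := by
    refine abs_le_of_sq_le_sq' ?_ (by norm_num) |>.2
    have hK2 : K ^ 2 * Real.exp (1 - Real.exp 1) = 1 := by
      rw [hK, ← Real.exp_nat_mul, ← Real.exp_add, Real.exp_eq_one_iff]
      push_cast
      ring
    rw [mul_pow, Real.sq_sqrt hc0.le]
    nlinarith [mul_le_mul_of_nonneg_left hc1.le (sq_nonneg K)]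
  set R := ⨆ θ ∈ ThetaM n m,
    ∫⁻ y, ENNReal.ofReal ((Qhat y - ∑ j, (θ j) ^ 2) ^ 2) ∂(prodGaussian n θ)
  let θ : Finset (Fin m) → Fin m → ℝ := fun S j => if j ∈ S then 1 / Real.sqrt n else 0
  have hsn : 1 / Real.sqrt n * (1 / Real.sqrt n) = 1 / n := by
    rw [div_mul_div_comm, Real.mul_self_sqrt hn.le, one_mul]
  have h_inner : ∀ S T, ∑ j, θ S j * θ T j = (S ∩ T).card / n := by
    intro S T
    have : ∀ j, θ S j * θ T j = if j ∈ S ∩ T then 1 / n else 0 := by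
      intro j
      by_cases h1 : j ∈ S <;> by_cases h2 : j ∈ T <;> simp only [θ, h1, h2, Finset.mem_inter,
        if_true, if_false, hsn, mul_zero, zero_mul, and_true, and_false]
    simp_rw [this]
    rw [Finset.sum_ite_mem, Finset.univ_inter, Finset.sum_const, nsmul_eq_mul, mul_one_div]
  set s := Finset.powersetCard k (Finset.univ : Finset (Fin m)) with hs
  have hs_card : s.card = m.choose k := by simp [hs]
  have hs_ne : s.Nonempty := by
    rw [← Finset.card_pos, hs_card]
    exact Nat.choose_pos hkm
  have key := ofReal_sq_le_add_of_mixture (μ := prodGaussian n (0 : Fin m → ℝ)) (R := R)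
    (L := fun S => gaussianLikelihood n (θ S)) (g := fun S T => Real.exp (S ∩ T).card)
    (q := k / n) (t := 4 * K * n / (Real.sqrt c * Real.sqrt m)) (C := (4 * K) ^ 2)
    (B := c * m / n ^ 2) hs_ne
    (fun S => measurable_gaussianLikelihood n _) (fun S => gaussianLikelihood_nonneg n _)
    (fun S _ => lintegral_gaussianLikelihood hn _) (fun S T => (Real.exp_pos _).le)
    (fun S _ T _ => by
      rw [lintegral_gaussianLikelihood_mul hn, h_inner, mul_div_cancel₀ _ hn.ne'])
    (fun S hS => by
      have hScard : S.card = k := (Finset.mem_powersetCard.mp hS).2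
      have h := sum_powersetCard_pow_card_inter_le hm0 S hScard (x := Real.exp 1 - 1)
        (by linarith [Real.one_le_exp zero_le_one])
      simp only [add_sub_cancel, Real.exp_one_pow] at h
      rw [hs_card]
      exact h.trans (mul_le_mul_of_nonneg_left (one_add_mul_div_pow_le hm0 hk32) (by positivity)))
    hQmeas (by positivity) (by positivity) (by positivity) hQ
    (fun S hS => by
      have hScard : S.card = k := (Finset.mem_powersetCard.mp hS).2
      have hmem : θ S ∈ ThetaM n m := Or.inr ⟨S, hScard, rfl⟩
      have hq : ∑ j, θ S j ^ 2 = k / n := by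
        simp_rw [sq, h_inner, Finset.inter_self, hScard]
      rw [← prodGaussian_eq_withDensity hn, ← hq]
      exact le_iSup₂_of_le (θ S) hmem le_rfl)
  rw [← tsub_le_iff_right, ← ENNReal.ofReal_sub _ (by positivity)] at key
  refine le_trans (ENNReal.ofReal_le_ofReal ?_) key
  have hsc : 0 < Real.sqrt c := Real.sqrt_pos.mpr hc0
  have hsm : 0 < Real.sqrt m := by linarith
  have hcc : Real.sqrt c ^ 2 = c := Real.sq_sqrt hc0.le
  have h_eq : (k / n : ℝ) * (4 * K * n / (Real.sqrt c * Real.sqrt m) * (c * m / n ^ 2) +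
      (4 * K) ^ 2 / (4 * K * n / (Real.sqrt c * Real.sqrt m))) =
      8 * K * Real.sqrt c * (k * Real.sqrt m) / n ^ 2 := by
    nth_rewrite 2 [← hcc]
    nth_rewrite 2 [← hw2]
    field_simp
    ring
  rw [h_eq, div_pow, ← sub_div]
  gcongr
  have h_sq : (1 / 4 - 2 * K * Real.sqrt c) * (m : ℝ) =
      (1 / 4 - 2 * K * Real.sqrt c) * Real.sqrt m ^ 2 := by rw [hw2]
  rw [h_sq]
  nlinarith [mul_nonneg (sub_nonneg.mpr hKc)
    (mul_nonneg hsm.le (by linarith : 0 ≤ 4 * (k : ℝ) - Real.sqrt m)),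
    mul_nonneg (by positivity : (0 : ℝ) ≤ k) (sub_nonneg.mpr hwk)]
end

section
/- Let m ≥ 4 be an integer and k = ⌈m^{1/2}⌉. Then Σ_{j=0}^{k} e^j · C(k, j) · C(m − k, k − j) / C(m, k) ≤ 4 e^{e−1}, where C(a, b) denotes the binomial coefficient (equal to 0 when b > a). -/
open Real

theorem Nat.descFactorial_mul_pow_le {r m : ℕ} (h : r ≤ m) (i : ℕ) :
    r.descFactorial i * m ^ i ≤ m.descFactorial i * r ^ i := by
  induction i with
  | zero => simp
  | succ i ih =>
    have hstep : (r - i) * m ≤ (m - i) * r := by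
      rw [Nat.sub_mul, Nat.sub_mul, mul_comm m r]
      exact Nat.sub_le_sub_left (Nat.mul_le_mul_left i h) _
    calc r.descFactorial (i + 1) * m ^ (i + 1)
        = ((r - i) * m) * (r.descFactorial i * m ^ i) := by
          rw [Nat.descFactorial_succ]; ring
      _ ≤ ((m - i) * r) * (m.descFactorial i * r ^ i) := Nat.mul_le_mul hstep ih
      _ = m.descFactorial (i + 1) * r ^ (i + 1) := by
          rw [Nat.descFactorial_succ]; ring

theorem Nat.choose_mul_pow_le {r m : ℕ} (h : r ≤ m) (i : ℕ) :
    r.choose i * m ^ i ≤ m.choose i * r ^ i := by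
  have := Nat.descFactorial_mul_pow_le h i
  rw [Nat.descFactorial_eq_factorial_mul_choose, Nat.descFactorial_eq_factorial_mul_choose,
    mul_assoc, mul_assoc] at this
  exact Nat.le_of_mul_le_mul_left this i.factorial_pos

/-- The binomial moments of the hypergeometric distribution, before normalization. -/
theorem sum_choose_mul_choose_mul_choose {a i r : ℕ} (n : ℕ) (ha : i ≤ a) (hr : i ≤ r) :
    ∑ j ∈ Finset.range (r + 1), j.choose i * a.choose j * n.choose (r - j) =
      a.choose i * (a + n - i).choose (r - i) := by
  obtain ⟨s, rfl⟩ := Nat.exists_eq_add_of_le hr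
  rw [show i + s + 1 = i + (s + 1) by ring, Finset.sum_range_add,
    Finset.sum_eq_zero fun j hj => by
      rw [Nat.choose_eq_zero_of_lt (Finset.mem_range.mp hj), zero_mul, zero_mul],
    zero_add, show a + n - i = (a - i) + n by omega, Nat.add_sub_cancel_left,
    Nat.add_choose_eq, Finset.Nat.sum_antidiagonal_eq_sum_range_succ_mk, Finset.mul_sum]
  refine Finset.sum_congr rfl fun j _ => ?_
  have := Nat.choose_mul (n := a) (k := i + j) (s := i) (by omega)
  rw [Nat.add_sub_cancel_left] at this
  rw [mul_comm ((i + j).choose i), this, Nat.add_sub_add_left, mul_assoc]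

theorem sum_choose_mul_choose_mul_choose_mul_pow_le {a n r : ℕ} (h : r ≤ a + n) (i : ℕ) :
    (∑ j ∈ Finset.range (r + 1), j.choose i * a.choose j * n.choose (r - j)) * (a + n) ^ i ≤
      a.choose i * r ^ i * (a + n).choose r := by
  rcases lt_or_ge r i with hr | hr
  · rw [Finset.sum_eq_zero fun j hj => by
      rw [Nat.choose_eq_zero_of_lt (by have := Finset.mem_range.mp hj; omega), zero_mul,
        zero_mul], zero_mul]
    exact Nat.zero_le _
  rcases lt_or_ge a i with ha | ha
  · rw [Finset.sum_eq_zero fun j _ => by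
      rcases lt_or_ge j i with hj | hj
      · rw [Nat.choose_eq_zero_of_lt hj, zero_mul, zero_mul]
      · rw [Nat.choose_eq_zero_of_lt (ha.trans_le hj), mul_zero, zero_mul], zero_mul]
    exact Nat.zero_le _
  rw [sum_choose_mul_choose_mul_choose n ha hr, mul_assoc, mul_assoc]
  refine Nat.mul_le_mul_left _ ?_
  refine Nat.le_of_mul_le_mul_left ?_ (Nat.choose_pos (hr.trans h))
  calc (a + n).choose i * ((a + n - i).choose (r - i) * (a + n) ^ i)
      = (a + n).choose r * (r.choose i * (a + n) ^ i) := by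
        rw [← mul_assoc, ← Nat.choose_mul hr, mul_assoc]
    _ ≤ (a + n).choose r * ((a + n).choose i * r ^ i) :=
        Nat.mul_le_mul_left _ (Nat.choose_mul_pow_le h i)
    _ = _ := by ring

theorem add_one_pow_eq_sum_range_of_le (y : ℝ) {j a : ℕ} (h : j ≤ a) :
    (y + 1) ^ j = ∑ i ∈ Finset.range (a + 1), y ^ i * (j.choose i : ℝ) := by
  rw [add_pow]
  simp only [one_pow, mul_one]
  refine Finset.sum_subset (Finset.range_mono (by omega)) fun i _ hi => ?_
  rw [Nat.choose_eq_zero_of_lt (by simpa using hi), Nat.cast_zero, mul_zero]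

/-- The hypergeometric probability generating function at `y + 1` is at most the binomial one. -/
theorem sum_pow_mul_choose_mul_choose_le {a n r : ℕ} (h : r ≤ a + n) (hpos : 0 < a + n)
    {y : ℝ} (hy : 0 ≤ y) :
    ∑ j ∈ Finset.range (r + 1), (y + 1) ^ j * (a.choose j : ℝ) * (n.choose (r - j) : ℝ) ≤
      (y * (r / (a + n : ℕ)) + 1) ^ a * ((a + n).choose r : ℝ) := by
  have hm : (0 : ℝ) < (a + n : ℕ) := by exact_mod_cast hpos
  calc ∑ j ∈ Finset.range (r + 1), (y + 1) ^ j * (a.choose j : ℝ) * (n.choose (r - j) : ℝ)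
      = ∑ j ∈ Finset.range (r + 1), ∑ i ∈ Finset.range (a + 1),
          y ^ i * ((j.choose i : ℝ) * (a.choose j : ℝ) * (n.choose (r - j) : ℝ)) := by
        refine Finset.sum_congr rfl fun j _ => ?_
        rcases lt_or_ge a j with hj | hj
        · simp [Nat.choose_eq_zero_of_lt hj]
        · rw [add_one_pow_eq_sum_range_of_le y hj, Finset.sum_mul, Finset.sum_mul]
          exact Finset.sum_congr rfl fun i _ => by ring
    _ = ∑ i ∈ Finset.range (a + 1), y ^ i * ∑ j ∈ Finset.range (r + 1),
          ((j.choose i : ℝ) * (a.choose j : ℝ) * (n.choose (r - j) : ℝ)) := by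
        rw [Finset.sum_comm]
        simp only [Finset.mul_sum]
    _ ≤ ∑ i ∈ Finset.range (a + 1), y ^ i *
          ((a.choose i : ℝ) * (r / (a + n : ℕ)) ^ i * ((a + n).choose r : ℝ)) := by
        refine Finset.sum_le_sum fun i _ => mul_le_mul_of_nonneg_left ?_ (pow_nonneg hy i)
        have key : (_ : ℝ) ≤ _ :=
          Nat.cast_le.mpr (sum_choose_mul_choose_mul_choose_mul_pow_le h i)
        rw [div_pow, mul_div_assoc', div_mul_eq_mul_div, le_div_iff₀ (pow_pos hm i)]
        simpa only [Nat.cast_mul, Nat.cast_sum, Nat.cast_pow] using key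
    _ = (y * (r / (a + n : ℕ)) + 1) ^ a * ((a + n).choose r : ℝ) := by
        rw [add_one_pow_eq_sum_range_of_le _ le_rfl, Finset.sum_mul]
        exact Finset.sum_congr rfl fun i _ => by ring

theorem five_mul_ceil_sqrt_sq_le {m : ℕ} (hm : 4 ≤ m) :
    5 * ⌈√(m : ℝ)⌉₊ ^ 2 ≤ 9 * m := by
  set k := ⌈√(m : ℝ)⌉₊ with hk
  rcases hm.eq_or_lt with rfl | hm5
  · have : k ≤ 2 := Nat.ceil_le.mpr (Real.sqrt_le_iff.mpr (by norm_num))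
    nlinarith
  have h3 : 2 < k := Nat.lt_ceil.mpr (Real.lt_sqrt_of_sq_lt (by
    have : (5 : ℝ) ≤ m := by exact_mod_cast hm5
    push_cast; linarith))
  obtain ⟨l, hl⟩ : ∃ l, k = l + 3 := ⟨k - 3, by omega⟩
  have hlt : (l + 2) ^ 2 < m := by
    have h : ((l + 2 : ℕ) : ℝ) < √m := Nat.lt_ceil.mp (by omega)
    exact_mod_cast (Real.lt_sqrt (Nat.cast_nonneg _)).mp h
  rw [hl]
  nlinarith

theorem exp_nine_fifths_mul_le :
    Real.exp ((Real.exp 1 - 1) * (9 / 5)) ≤ 4 * Real.exp (Real.exp 1 - 1) := by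
  have h4 : (4 : ℝ) = Real.exp (2 * Real.log 2) := by
    rw [two_mul, Real.exp_add, Real.exp_log two_pos]; norm_num
  rw [h4, ← Real.exp_add, Real.exp_le_exp]
  linarith [Real.exp_one_lt_d9, Real.log_two_gt_d9]

/-- with `k = ⌈√m⌉` and `m ≥ 4`, the hypergeometric expectation of `e^J`
satisfies `∑_{j=0}^k e^j C(k,j) C(m-k, k-j) / C(m,k) ≤ 4 e^{e-1}`. -/
theorem hypergeometric_exp_bound (m : ℕ) (hm : 4 ≤ m) :
    ∑ j ∈ Finset.range (⌈Real.sqrt m⌉₊ + 1),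
        Real.exp j * (Nat.choose ⌈Real.sqrt m⌉₊ j : ℝ) *
          (Nat.choose (m - ⌈Real.sqrt m⌉₊) (⌈Real.sqrt m⌉₊ - j) : ℝ) /
          (Nat.choose m ⌈Real.sqrt m⌉₊ : ℝ) ≤
      4 * Real.exp (Real.exp 1 - 1) := by
  have hsq := five_mul_ceil_sqrt_sq_le hm
  set k := ⌈√(m : ℝ)⌉₊
  have hkm : k ≤ m := Nat.ceil_le.mpr (Real.sqrt_le_iff.mpr ⟨Nat.cast_nonneg _, by
    have : (4 : ℝ) ≤ m := by exact_mod_cast hm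
    nlinarith⟩)
  have hm0 : (0 : ℝ) < m := by exact_mod_cast (by omega : 0 < m)
  have hy : 0 ≤ Real.exp 1 - 1 := by linarith [Real.add_one_le_exp 1]
  have hadd : k + (m - k) = m := Nat.add_sub_cancel' hkm
  have hle := sum_pow_mul_choose_mul_choose_le (a := k) (n := m - k) (r := k) (by omega)
    (by omega) hy
  rw [hadd, sub_add_cancel] at hle
  rw [← Finset.sum_div, div_le_iff₀ (by exact_mod_cast Nat.choose_pos hkm)]
  simp only [← Real.exp_one_pow]
  refine hle.trans (mul_le_mul_of_nonneg_right ?_ (Nat.cast_nonneg _))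
  calc ((Real.exp 1 - 1) * (k / m) + 1) ^ k
      ≤ Real.exp ((Real.exp 1 - 1) * (k / m)) ^ k :=
        pow_le_pow_left₀ (by positivity) (Real.add_one_le_exp _) k
    _ = Real.exp ((Real.exp 1 - 1) * ((k : ℝ) ^ 2 / m)) := by
        rw [← Real.exp_nat_mul]; congr 1; ring
    _ ≤ Real.exp ((Real.exp 1 - 1) * (9 / 5)) := by
        refine Real.exp_le_exp.mpr (mul_le_mul_of_nonneg_left ?_ hy)
        rw [div_le_iff₀ hm0]
        have : (5 : ℝ) * (k : ℝ) ^ 2 ≤ 9 * m := by exact_mod_cast hsq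
        linarith
    _ ≤ _ := exp_nine_fifths_mul_le
end
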